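/- Let Δ be a d-dimensional stacked simplicial complex and let σ be a nonempty face of Δ that is not a facet. Then the link of σ in Δ, link_Δ σ = {τ ∈ Δ : τ ∪ σ ∈ Δ and τ ∩ σ = ∅}, is a stacked simplicial complex (of dimension d − |σ|), with a stacked shelling induced by restricting a stacked shelling of Δ to the facets containing σ. -/

import Mathlib

open Finset

/-- The facets (maximal faces) of `Δ`. -/
def facets {V : Type*} [DecidableEq V] (Δ : Finset (Finset V)) : Finset (Finset V) :=
  Δ.filter fun F => ∀ G ∈ Δ, F ⊆ G → F = G

/-- The link of a face `σ` in `Δ`. -/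
def linkC {V : Type*} [DecidableEq V] (Δ : Finset (Finset V)) (σ : Finset V) :
    Finset (Finset V) :=
  Δ.filter fun τ => τ ∪ σ ∈ Δ ∧ τ ∩ σ = ∅

/-- The complex generated by a list of faces: all subsets of the members of `L`. -/
def genL {V : Type*} [DecidableEq V] (L : List (Finset V)) : Finset (Finset V) :=
  L.toFinset.biUnion Finset.powerset

/-- `L = [F_1, …, F_j]` is a stacked shelling of a pure `d`-dimensional complex:
the `F_l` are distinct faces of cardinality `d + 1` and, for each `1 ≤ i ≤ j - 1`,
`⟨F_1, …, F_i⟩ ∩ ⟨F_{i+1}⟩` is the powerset of some `d`-element subset of `F_{i+1}`. -/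
def IsStackedShelling {V : Type*} [DecidableEq V] (d : ℕ) (L : List (Finset V)) : Prop :=
  L ≠ [] ∧ L.Nodup ∧ (∀ F ∈ L, F.card = d + 1) ∧
  ∀ i : Fin L.length, 0 < i.1 →
    ∃ R ⊆ L.get i, R.card = d ∧ genL (L.take i.1) ∩ (L.get i).powerset = R.powerset

/-- A stacked simplicial complex of dimension `d`: one generated by a stacked shelling. -/
def IsStacked {V : Type*} [DecidableEq V] (Δ : Finset (Finset V)) (d : ℕ) : Prop :=
  ∃ L : List (Finset V), IsStackedShelling d L ∧ Δ = genL L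

theorem mem_genL {V : Type*} [DecidableEq V] {L : List (Finset V)} {τ : Finset V} :
    τ ∈ genL L ↔ ∃ F ∈ L, τ ⊆ F := by
  simp [genL]

/-- The shelling condition, stated through the splittings of the list. -/
theorem forall_get_take_iff_forall_split {α : Type*} (L : List α) (P : List α → α → Prop) :
    (∀ i : Fin L.length, 0 < i.1 → P (L.take i.1) (L.get i)) ↔
      ∀ A F B, L = A ++ F :: B → A ≠ [] → P A F := by
  constructor
  · rintro h A F B rfl hA
    have := h ⟨A.length, by simp⟩ (List.length_pos_iff.2 hA)
    simpa using this
  · intro h i hi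
    refine h _ _ (L.drop (i.1 + 1)) ?_ ?_
    · simp
    · intro h0
      have := congrArg List.length h0
      have := i.2
      simp at *
      omega

theorem card_le_of_mem_genL_of_notMem_facets {V : Type*} [DecidableEq V] {d : ℕ}
    {L : List (Finset V)} {σ : Finset V} (hcard : ∀ F ∈ L, F.card = d + 1)
    (hσ : σ ∈ genL L) (hσnf : σ ∉ facets (genL L)) : σ.card ≤ d := by
  simp only [facets, mem_filter, hσ, true_and, not_forall] at hσnf
  obtain ⟨G, hG, hσG, hne⟩ := hσnf
  obtain ⟨F, hF, hGF⟩ := mem_genL.1 hG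
  have h1 := card_lt_card (hσG.ssubset_of_ne hne)
  have h2 := card_le_card hGF
  have h3 := hcard F hF
  omega

theorem linkC_genL {V : Type*} [DecidableEq V] (L : List (Finset V)) (σ : Finset V) :
    linkC (genL L) σ = genL ((L.filter fun F => decide (σ ⊆ F)).map fun F => F \ σ) := by
  ext τ
  simp only [linkC, mem_filter, mem_genL, List.mem_map, List.mem_filter, decide_eq_true_eq,
    ← disjoint_iff_inter_eq_empty]
  constructor
  · rintro ⟨-, ⟨F, hF, hτσ⟩, hd⟩
    obtain ⟨hτ, hσ⟩ := union_subset_iff.1 hτσ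
    exact ⟨F \ σ, ⟨F, ⟨hF, hσ⟩, rfl⟩, subset_sdiff.2 ⟨hτ, hd⟩⟩
  · rintro ⟨_, ⟨F, ⟨hF, hσ⟩, rfl⟩, hτ⟩
    obtain ⟨hτ, hd⟩ := subset_sdiff.1 hτ
    exact ⟨⟨F, hF, hτ⟩, ⟨F, hF, union_subset hτ hσ⟩, hd⟩

theorem IsStackedShelling.link {V : Type*} [DecidableEq V] {d : ℕ} {L : List (Finset V)}
    (hL : IsStackedShelling d L) {σ : Finset V} (hσ : σ ∈ genL L) (hσd : σ.card ≤ d) :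
    IsStackedShelling (d - σ.card)
      ((L.filter fun F => decide (σ ⊆ F)).map fun F => F \ σ) := by
  obtain ⟨-, hnd, hcard, hsh⟩ := hL
  have hsplit := (forall_get_take_iff_forall_split L fun A F =>
    ∃ R ⊆ F, R.card = d ∧ genL A ∩ F.powerset = R.powerset).1 hsh
  refine ⟨?_, ?_, ?_, ?_⟩
  · obtain ⟨F, hF, hσF⟩ := mem_genL.1 hσ
    exact List.ne_nil_of_mem (List.mem_map_of_mem (List.mem_filter.2 ⟨hF, by simpa using hσF⟩))
  · refine List.Nodup.map_on ?_ (hnd.filter _)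
    intro F hF G hG h
    simp only [List.mem_filter, decide_eq_true_eq] at hF hG
    rw [← sdiff_union_of_subset hF.2, ← sdiff_union_of_subset hG.2, h]
  · intro G hG
    simp only [List.mem_map, List.mem_filter, decide_eq_true_eq] at hG
    obtain ⟨F, ⟨hF, hσF⟩, rfl⟩ := hG
    rw [card_sdiff_of_subset hσF, hcard F hF]
    omega
  · refine (forall_get_take_iff_forall_split _ fun (A : List (Finset V)) (F : Finset V) =>
      ∃ R ⊆ F, R.card = d - σ.card ∧ genL A ∩ F.powerset = R.powerset).2 ?_
    intro A' F' B' h hA'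
    obtain ⟨A₁, C₁, hfilter, rfl, hC⟩ := List.map_eq_append_iff.1 h
    obtain ⟨F, B₁, rfl, rfl, rfl⟩ := List.map_eq_cons_iff.1 hC
    obtain ⟨A₂, C₂, rfl, rfl, hC₂⟩ := List.filter_eq_append_iff.1 hfilter
    obtain ⟨A₃, B₃, rfl, hA₃, hσF, -⟩ := List.filter_eq_cons_iff.1 hC₂
    simp only [decide_eq_true_eq] at hA₃ hσF
    have hmem : ∀ G, G ∈ A₂ ++ A₃ → σ ⊆ G → G ∈ A₂ := fun G hG hσG =>
      (List.mem_append.1 hG).resolve_right fun h => hA₃ G h hσG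
    obtain ⟨K, hK⟩ := List.exists_mem_of_ne_nil _ fun h0 => hA' (List.map_eq_nil_iff.2 h0)
    simp only [List.mem_filter, decide_eq_true_eq] at hK
    obtain ⟨R, hRF, hRd, hR⟩ := hsplit (A₂ ++ A₃) F B₃ (by simp) fun h0 => by
      simp [(List.append_eq_nil_iff.1 h0).1] at hK
    have key : ∀ τ, (∃ G ∈ A₂ ++ A₃, τ ⊆ G) ∧ τ ⊆ F ↔ τ ⊆ R := fun τ => by
      rw [← mem_powerset (t := R), ← hR, mem_inter, mem_genL, mem_powerset]
    have hσR : σ ⊆ R := (key σ).1 ⟨⟨K, List.mem_append_left _ hK.1, hK.2⟩, hσF⟩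
    obtain ⟨⟨G, hG, hRG⟩, -⟩ := (key R).2 Subset.rfl
    refine ⟨R \ σ, sdiff_subset_sdiff hRF Subset.rfl, ?_, ?_⟩
    · rw [card_sdiff_of_subset hσR, hRd]
    · ext τ
      simp only [mem_inter, mem_genL, mem_powerset, List.mem_map, List.mem_filter,
        decide_eq_true_eq]
      constructor
      · rintro ⟨⟨_, ⟨H, ⟨hH, hσH⟩, rfl⟩, hτH⟩, hτF⟩
        rw [subset_sdiff] at hτH hτF ⊢
        exact ⟨subset_union_left.trans ((key (τ ∪ σ)).1
          ⟨⟨H, List.mem_append_left _ hH, union_subset hτH.1 hσH⟩,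
            union_subset hτF.1 hσF⟩), hτF.2⟩
      · intro hτ
        exact ⟨⟨G \ σ, ⟨G, ⟨hmem G hG (hσR.trans hRG), hσR.trans hRG⟩, rfl⟩,
          hτ.trans (sdiff_subset_sdiff hRG Subset.rfl)⟩,
          hτ.trans (sdiff_subset_sdiff hRF Subset.rfl)⟩

/-- Let `Δ` be a `d`-dimensional stacked complex and let `σ` be a nonempty face of `Δ`
that is not a facet.  Then `link_Δ σ` is a stacked complex of dimension `d - |σ|`, with a
stacked shelling induced by restricting a stacked shelling of `Δ` to the facets
containing `σ` (and deleting `σ` from each of them). -/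
theorem link_of_stacked_is_stacked
    {V : Type*} [DecidableEq V] (Δ : Finset (Finset V)) (d : ℕ)
    (hΔ : IsStacked Δ d) (σ : Finset V)
    (hσ : σ ∈ Δ) (hσne : σ ≠ ∅) (hσnf : σ ∉ facets Δ) :
    ∃ L : List (Finset V), IsStackedShelling d L ∧ Δ = genL L ∧
      IsStackedShelling (d - σ.card)
        ((L.filter fun F => decide (σ ⊆ F)).map fun F => F \ σ) ∧
      linkC Δ σ = genL ((L.filter fun F => decide (σ ⊆ F)).map fun F => F \ σ) := by
  obtain ⟨L, hL, rfl⟩ := hΔ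
  exact ⟨L, hL, rfl,
    hL.link hσ (card_le_of_mem_genL_of_notMem_facets hL.2.2.1 hσ hσnf), linkC_genL L σ⟩
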